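/- arXiv:1312.6500 — 3 statements merged into one kernel-verified Lean document; each statement's English description precedes it below -/
import Mathlib

section
/- Let p ∈ 𝒜 with p ≥ 0 on Q, set w := w_p where w_p(x) = inf_{y∈Q₁}(c(x,y) + p(y)), define ũ(y) := inf_{x∈Q}(c(x,y) − w(x)) for y ∈ Q₁, and let p̃ := p₀ on Q₀ and p̃ := −ũ on Q₁. Then: (i) v_{p̃} = v_p on Q, p̃ ≤ p on Q₁, and p̃ ≥ 0 on Q; (ii) T_p(x) ∩ Q₁ ⊆ T_{p̃}(x) ∩ Q₁ for every x ∈ Ω₁(p); (iii) Ω₁(p) ⊆ Ω₁(p̃) = { x ∈ Q : w(x) ≤ v₀(x) }; (iv) T_{p̃}(x) ∩ Q₁ = ∂^{1,c} w(x) for every x ∈ Ω₁(p̃); and consequently (v) Π(p̃) ≥ Π(p) and Π(p̃) = ∫_{{w ≤ v₀}} ( w(x) − min_{y ∈ ∂^{1,c} w(x)} c(x,y) ) df(x). -/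
open Filter Set MeasureTheory
open scoped Classical

noncomputable section


/-- The minimal total expenditure `v_p(x) = min_y (c x y + p y)`. -/
def vprice {Q : Type*} (c : Q → Q → ℝ) (p : Q → ℝ) (x : Q) : ℝ :=
  ⨅ y, (c x y + p y)

/-- The set `T_p(x)` of optimal shopping locations for a customer living at `x`. -/
def Tprice {Q : Type*} (c : Q → Q → ℝ) (p : Q → ℝ) (x : Q) : Set Q :=
  {y | c x y + p y = vprice c p x}

/-- The set `Ω₁(p)` of customers that may rationally shop in the free region `Q₁`. -/
def Omega1 {Q : Type*} (c : Q → Q → ℝ) (p : Q → ℝ) (Q₁ : Set Q) : Set Q :=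
  {x | (Tprice c p x ∩ Q₁).Nonempty}

/-- The profit `Π(p) = ∫_{Ω₁(p)} (max_{y ∈ T_p(x) ∩ Q₁} p y) df(x)`. -/
def Profit {Q : Type*} [MeasurableSpace Q] (f : Measure Q) (c : Q → Q → ℝ)
    (p : Q → ℝ) (Q₁ : Set Q) : ℝ :=
  ∫ x in Omega1 c p Q₁, sSup (p '' (Tprice c p x ∩ Q₁)) ∂f

/-- The `c`-transform (over all of `Q`) of `w`: `w^c(y) = inf_{x ∈ Q} (c x y - w x)`. -/
def ctransform {Q : Type*} (c : Q → Q → ℝ) (w : Q → ℝ) (y : Q) : ℝ :=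
  ⨅ x, (c x y - w x)

/-- The `(Q₁,c)`-superdifferential `∂^{1,c} w(x) = {y ∈ Q₁ : w x + w^c y = c x y}`. -/
def QcSuperdiff {Q : Type*} (c : Q → Q → ℝ) (Q₁ : Set Q) (w : Q → ℝ) (x : Q) :
    Set Q :=
  {y ∈ Q₁ | w x + ctransform c w y = c x y}

theorem upperSemicontinuous_sInf_image {X Y : Type*} [TopologicalSpace X] {F : X → Y → ℝ}
    {S : Set Y} (hF : ∀ y, Continuous fun x => F x y) (hb : ∀ x, BddBelow (F x '' S)) :
    UpperSemicontinuous fun x => sInf (F x '' S) := by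
  simp only [sInf_image']
  refine upperSemicontinuous_ciInf (fun x => ?_) fun y => (hF y).upperSemicontinuous
  simpa [Set.image_eq_range] using hb x

theorem upperSemicontinuous_sSup_image_section {X Y : Type*} [TopologicalSpace X]
    [TopologicalSpace Y] [CompactSpace Y] {R : Set (X × Y)} (hR : IsClosed R)
    (hne : ∀ x, ∃ y, (x, y) ∈ R) {h : X × Y → ℝ} (hh : UpperSemicontinuous h) :
    UpperSemicontinuous fun x => sSup ((fun y => h (x, y)) '' {y | (x, y) ∈ R}) := by
  rw [upperSemicontinuous_iff_isClosed_preimage]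
  intro t
  have hproj : IsClosed (Prod.fst '' (R ∩ h ⁻¹' Ici t)) :=
    isClosedMap_fst_of_compactSpace _
      (hR.inter (upperSemicontinuous_iff_isClosed_preimage.1 hh t))
  convert hproj using 1
  ext x
  have hcomp : IsCompact {y | (x, y) ∈ R} :=
    (hR.preimage (Continuous.prodMk_right x)).isCompact
  have husc : UpperSemicontinuous fun y => h (x, y) :=
    hh.comp (Continuous.prodMk_right x)
  obtain ⟨y, hy, hmax⟩ := (husc.upperSemicontinuousOn _).exists_isMaxOn (hne x) hcomp
  have hgreatest : IsGreatest ((fun y => h (x, y)) '' {y | (x, y) ∈ R}) (h (x, y)) :=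
    ⟨mem_image_of_mem _ hy, by rintro _ ⟨z, hz, rfl⟩; exact hmax hz⟩
  simp only [mem_preimage, mem_Ici, hgreatest.csSup_eq]
  constructor
  · exact fun ht => ⟨(x, y), ⟨hy, ht⟩, rfl⟩
  · rintro ⟨⟨x', z⟩, ⟨hz, ht⟩, rfl⟩
    exact le_trans ht (hmax hz)

/-- The reformulation proposition: replacing an admissible nonnegative price `p` by
the price `p̃` (equal to `p₀` on `Q₀` and to `-ũ` on `Q₁`, where `ũ = (w_p)^c`)
preserves `v_p`, lowers prices on `Q₁`, keeps them nonnegative, enlarges the sets of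
profitable customers, identifies `T_{p̃} ∩ Q₁` with `∂^{1,c} w`, improves the profit,
and allows to rewrite the profit in terms of `w` only. -/
theorem price_reformulation
    {Q : Type*} [MetricSpace Q] [CompactSpace Q] [Nonempty Q]
    [MeasurableSpace Q] [BorelSpace Q]
    (Q₀ : Set Q) (hQ₀ : IsOpen Q₀) (hQ₀ne : Q₀.Nonempty) (hQ₁ : Q₀ᶜ.Nonempty)
    (c : Q → Q → ℝ) (hc : Continuous fun z : Q × Q => c z.1 z.2)
    (hc0 : ∀ x y, 0 ≤ c x y) (hcd : ∀ x, c x x = 0)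
    (p₀ : Q → ℝ) (hp₀lsc : LowerSemicontinuousOn p₀ Q₀) (hp₀0 : ∀ x ∈ Q₀, 0 ≤ p₀ x)
    (f : Measure Q) [IsFiniteMeasure f]
    (p : Q → ℝ) (hplsc : LowerSemicontinuous p) (hpQ₀ : ∀ x ∈ Q₀, p x = p₀ x)
    (hp0 : ∀ x, 0 ≤ p x)
    (w : Q → ℝ) (hw : ∀ x, w x = sInf ((fun y => c x y + p y) '' Q₀ᶜ))
    (ut : Q → ℝ) (hut : ∀ y, ut y = ⨅ x, (c x y - w x))
    (pt : Q → ℝ) (hpt : ∀ x, pt x = if x ∈ Q₀ then p₀ x else -ut x)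
    (v₀ : Q → ℝ) (hv₀ : ∀ x, v₀ x = sInf ((fun y => c x y + p₀ y) '' Q₀)) :
    -- (i)
    ((∀ x, vprice c pt x = vprice c p x) ∧ (∀ x ∈ Q₀ᶜ, pt x ≤ p x) ∧ (∀ x, 0 ≤ pt x)) ∧
    -- (ii)
    (∀ x ∈ Omega1 c p Q₀ᶜ, Tprice c p x ∩ Q₀ᶜ ⊆ Tprice c pt x ∩ Q₀ᶜ) ∧
    -- (iii)
    (Omega1 c p Q₀ᶜ ⊆ Omega1 c pt Q₀ᶜ ∧ Omega1 c pt Q₀ᶜ = {x | w x ≤ v₀ x}) ∧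
    -- (iv)
    (∀ x ∈ Omega1 c pt Q₀ᶜ, Tprice c pt x ∩ Q₀ᶜ = QcSuperdiff c Q₀ᶜ w x) ∧
    -- (v)
    (Profit f c p Q₀ᶜ ≤ Profit f c pt Q₀ᶜ ∧
      Profit f c pt Q₀ᶜ =
        ∫ x in {x | w x ≤ v₀ x},
          (w x - sInf ((fun y => c x y) '' QcSuperdiff c Q₀ᶜ w x)) ∂f) := by
  obtain rfl : ut = ctransform c w := funext hut
  have hbw : ∀ x, BddBelow ((fun y => c x y + p y) '' Q₀ᶜ) := fun x =>
    ⟨0, by rintro _ ⟨y, -, rfl⟩; exact add_nonneg (hc0 x y) (hp0 y)⟩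
  have hbv₀ : ∀ x, BddBelow ((fun y => c x y + p₀ y) '' Q₀) := fun x =>
    ⟨0, by rintro _ ⟨y, hy, rfl⟩; exact add_nonneg (hc0 x y) (hp₀0 y hy)⟩
  have hwle : ∀ x, ∀ y ∈ Q₀ᶜ, w x ≤ c x y + p y := fun x y hy => by
    rw [hw]; exact csInf_le (hbw x) ⟨y, hy, rfl⟩
  have hw0 : ∀ x, 0 ≤ w x := fun x => by
    rw [hw]
    refine le_csInf (hQ₁.image _) ?_
    rintro _ ⟨y, -, rfl⟩; exact add_nonneg (hc0 x y) (hp0 y)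
  have hv₀le : ∀ x, ∀ y ∈ Q₀, v₀ x ≤ c x y + p₀ y := fun x y hy => by
    rw [hv₀]; exact csInf_le (hbv₀ x) ⟨y, hy, rfl⟩
  have hcy : ∀ y, Continuous fun x => c x y := fun y => hc.comp (Continuous.prodMk_left y)
  have hcx : ∀ x, Continuous fun y => c x y := fun x => hc.comp (Continuous.prodMk_right x)
  have hwatt : ∀ x, ∃ y ∈ Q₀ᶜ, w x = c x y + p y := fun x => by
    obtain ⟨y, hy, hmin⟩ := (((hcx x).lowerSemicontinuous.add hplsc).lowerSemicontinuousOn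
      Q₀ᶜ).exists_isMinOn hQ₁ hQ₀.isClosed_compl.isCompact
    refine ⟨y, hy, le_antisymm (hwle x y hy) ?_⟩
    rw [hw]
    refine le_csInf (hQ₁.image _) ?_
    rintro _ ⟨z, hz, rfl⟩; exact hmin hz
  have hwusc : UpperSemicontinuous w := by
    rw [funext hw]
    exact upperSemicontinuous_sInf_image (fun y => (hcy y).add continuous_const) hbw
  have hv₀usc : UpperSemicontinuous v₀ := by
    rw [funext hv₀]
    exact upperSemicontinuous_sInf_image (fun y => (hcy y).add continuous_const) hbv₀
  obtain ⟨C, hC⟩ : ∃ C, ∀ x, w x ≤ C := by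
    obtain ⟨y, hy⟩ := hQ₁
    obtain ⟨C, hC⟩ := (isCompact_range (hcy y)).bddAbove
    exact ⟨C + p y, fun x => (hwle x y hy).trans (by gcongr; exact hC ⟨x, rfl⟩)⟩
  have hbu : ∀ y, BddBelow (range fun x => c x y - w x) := fun y =>
    ⟨-C, by rintro _ ⟨x, rfl⟩; simp only; linarith [hC x, hc0 x y]⟩
  have hule : ∀ x y, w x + ctransform c w y ≤ c x y := fun x y => by
    have := ciInf_le (hbu y) x
    unfold ctransform; linarith
  have hpt₀ : ∀ y ∈ Q₀, pt y = p₀ y := fun y hy => by rw [hpt, if_pos hy]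
  have hpt₁ : ∀ y ∈ Q₀ᶜ, pt y = -ctransform c w y := fun y hy => by rw [hpt, if_neg hy]
  have hptle₁ : ∀ y ∈ Q₀ᶜ, pt y ≤ p y := fun y hy => by
    rw [hpt₁ y hy, neg_le]
    exact le_ciInf fun x => by linarith [hwle x y hy]
  have hptle : ∀ y, pt y ≤ p y := fun y => by
    by_cases hy : y ∈ Q₀
    · rw [hpt₀ y hy, hpQ₀ y hy]
    · exact hptle₁ y hy
  have hpt0 : ∀ y, 0 ≤ pt y := fun y => by
    by_cases hy : y ∈ Q₀
    · rw [hpt₀ y hy]; exact hp₀0 y hy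
    · rw [hpt₁ y hy]; linarith [hule y y, hcd y, hw0 y]
  have hv_le : ∀ q : Q → ℝ, (∀ y, 0 ≤ q y) → ∀ x y, vprice c q x ≤ c x y + q y :=
    fun q hq x y => ciInf_le
      ⟨0, by rintro _ ⟨z, rfl⟩; exact add_nonneg (hc0 x z) (hq z)⟩ y
  have hvw : ∀ x, vprice c p x ≤ w x := fun x => by
    obtain ⟨y, -, hy⟩ := hwatt x
    exact hy ▸ hv_le p hp0 x y
  have hvv₀ : ∀ x, vprice c p x ≤ v₀ x := fun x => by
    rw [hv₀]
    refine le_csInf (hQ₀ne.image _) ?_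
    rintro _ ⟨y, hy, rfl⟩
    simpa only [hpQ₀ y hy] using hv_le p hp0 x y
  have hv : ∀ x, vprice c pt x = vprice c p x := fun x => by
    refine le_antisymm
      (le_ciInf fun y => (hv_le pt hpt0 x y).trans (by linarith [hptle y]))
      (le_ciInf fun y => ?_)
    by_cases hy : y ∈ Q₀
    · simpa only [hpt₀ y hy, hpQ₀ y hy] using hv_le p hp0 x y
    · linarith [hvw x, hpt₁ y hy, hule x y]
  have hvmin : ∀ x, w x ≤ v₀ x → vprice c p x = w x := fun x hx => by
    refine le_antisymm (hvw x) (le_ciInf fun y => ?_)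
    by_cases hy : y ∈ Q₀
    · rw [hpQ₀ y hy]; exact hx.trans (hv₀le x y hy)
    · exact hwle x y hy
  have hT : ∀ x, Tprice c p x ∩ Q₀ᶜ ⊆ Tprice c pt x ∩ Q₀ᶜ := by
    rintro x y ⟨hy, hy₁⟩
    refine ⟨le_antisymm ?_ (hv_le pt hpt0 x y), hy₁⟩
    have hy' : c x y + p y = vprice c p x := hy
    rw [hv x, ← hy']
    linarith [hptle y]
  have hsub : Omega1 c p Q₀ᶜ ⊆ Omega1 c pt Q₀ᶜ := fun x hx => hx.mono (hT x)
  have hΩle : Omega1 c pt Q₀ᶜ ⊆ {x | w x ≤ v₀ x} := by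
    rintro x ⟨y, hy, hy₁⟩
    have hy' : c x y + pt y = vprice c pt x := hy
    have := hpt₁ y hy₁
    change w x ≤ v₀ x
    linarith [hv x, hvv₀ x, hule x y]
  have hleΩ : {x | w x ≤ v₀ x} ⊆ Omega1 c p Q₀ᶜ := by
    intro x hx
    obtain ⟨y, hy₁, hy⟩ := hwatt x
    exact ⟨y, hy.symm.trans (hvmin x hx).symm, hy₁⟩
  have hΩ : Omega1 c p Q₀ᶜ = {x | w x ≤ v₀ x} := (hsub.trans hΩle).antisymm hleΩ
  have hΩt : Omega1 c pt Q₀ᶜ = {x | w x ≤ v₀ x} := hΩle.antisymm (hleΩ.trans hsub)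
  have hD : ∀ x, w x ≤ v₀ x → Tprice c pt x ∩ Q₀ᶜ = QcSuperdiff c Q₀ᶜ w x := by
    intro x hx
    ext y
    simp only [Tprice, QcSuperdiff, mem_inter_iff, mem_ofPred_eq, hv x, hvmin x hx]
    constructor
    · rintro ⟨hy, hy₁⟩
      exact ⟨hy₁, by linarith [hpt₁ y hy₁]⟩
    · rintro ⟨hy₁, hy⟩
      exact ⟨by linarith [hpt₁ y hy₁], hy₁⟩
  have hA : MeasurableSet {x | w x ≤ v₀ x} :=
    measurableSet_le hwusc.measurable hv₀usc.measurable
  have hDne : ∀ x, (QcSuperdiff c Q₀ᶜ w x).Nonempty := fun x => by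
    obtain ⟨y, hy₁, hy⟩ := hwatt x
    exact ⟨y, hy₁, le_antisymm (hule x y) (by linarith [hptle₁ y hy₁, hpt₁ y hy₁])⟩
  have hptD : ∀ x, pt '' QcSuperdiff c Q₀ᶜ w x
      = (fun y => w x - c x y) '' QcSuperdiff c Q₀ᶜ w x := fun x =>
    image_congr fun y hy => by linarith [hpt₁ y hy.1, hy.2]
  have hbdd : ∀ x, BddAbove (pt '' QcSuperdiff c Q₀ᶜ w x) := fun x => by
    rw [hptD]
    exact ⟨w x, by rintro _ ⟨y, -, rfl⟩; exact sub_le_self _ (hc0 x y)⟩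
  have hsup0 : ∀ x, 0 ≤ sSup (pt '' QcSuperdiff c Q₀ᶜ w x) := fun x =>
    Real.sSup_nonneg (by rintro _ ⟨y, -, rfl⟩; exact hpt0 y)
  have hsuple : ∀ x, sSup (pt '' QcSuperdiff c Q₀ᶜ w x) ≤ C := fun x => by
    rw [hptD]
    refine csSup_le ((hDne x).image _) ?_
    rintro _ ⟨y, -, rfl⟩
    exact (sub_le_self _ (hc0 x y)).trans (hC x)
  have hsupeq : ∀ x, sSup (pt '' QcSuperdiff c Q₀ᶜ w x)
      = w x - sInf ((fun y => c x y) '' QcSuperdiff c Q₀ᶜ w x) := fun x => by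
    have hb : BddBelow ((fun y => c x y) '' QcSuperdiff c Q₀ᶜ w x) :=
      ⟨0, by rintro _ ⟨y, -, rfl⟩; exact hc0 x y⟩
    rw [hptD]
    apply le_antisymm
    · refine csSup_le ((hDne x).image _) ?_
      rintro _ ⟨y, hy, rfl⟩
      exact sub_le_sub_left (csInf_le hb ⟨y, hy, rfl⟩) _
    · rw [sub_le_comm]
      refine le_csInf ((hDne x).image _) ?_
      rintro _ ⟨y, hy, rfl⟩
      rw [sub_le_comm]
      exact le_csSup (hptD x ▸ hbdd x) ⟨y, hy, rfl⟩
  have huusc : UpperSemicontinuous (ctransform c w) :=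
    upperSemicontinuous_ciInf hbu fun x =>
      ((hcx x).sub continuous_const).upperSemicontinuous
  have hw1 : UpperSemicontinuous fun z : Q × Q => w z.1 - c z.1 z.2 := by
    simp only [sub_eq_add_neg]
    exact (hwusc.comp continuous_fst).add hc.neg.upperSemicontinuous
  have hR : IsClosed {z : Q × Q | z.2 ∈ Q₀ᶜ ∧ w z.1 + ctransform c w z.2 = c z.1 z.2} := by
    convert (hQ₀.isClosed_compl.preimage continuous_snd).inter
      (upperSemicontinuous_iff_isClosed_preimage.1
        (hw1.add (huusc.comp continuous_snd)) 0) using 1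
    ext z
    have hz := hule z.1 z.2
    simp only [mem_ofPred_eq, mem_inter_iff, mem_preimage, mem_Ici, Function.comp_apply]
    refine and_congr_right fun _ => ?_
    constructor <;> intro h <;> linarith
  have hmeas : Measurable fun x => sSup (pt '' QcSuperdiff c Q₀ᶜ w x) := by
    simp only [hptD]
    exact (upperSemicontinuous_sSup_image_section hR hDne hw1).measurable
  have hint : Integrable (fun x => sSup (pt '' QcSuperdiff c Q₀ᶜ w x)) f :=
    Integrable.of_bound hmeas.aestronglyMeasurable C (ae_of_all _ fun x => by
      rw [Real.norm_of_nonneg (hsup0 x)]; exact hsuple x)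
  have hProfit : Profit f c pt Q₀ᶜ
      = ∫ x in {x | w x ≤ v₀ x}, sSup (pt '' QcSuperdiff c Q₀ᶜ w x) ∂f := by
    rw [Profit, hΩt]
    exact setIntegral_congr_fun hA fun x hx => by simp only [hD x hx]
  refine ⟨⟨hv, hptle₁, hpt0⟩, fun x _ => hT x, ⟨hsub, hΩt⟩,
    fun x hx => hD x (hΩle hx), ?_, ?_⟩
  · rw [hProfit, Profit, hΩ]
    by_cases hi : IntegrableOn (fun x => sSup (p '' (Tprice c p x ∩ Q₀ᶜ)))
        {x | w x ≤ v₀ x} f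
    · refine setIntegral_mono_on hi hint.integrableOn hA fun x hx => ?_
      refine csSup_le (Nonempty.image _ (hleΩ hx)) ?_
      rintro _ ⟨y, hy, rfl⟩
      have hyt := hT x hy
      have hp_eq : c x y + p y = vprice c p x := hy.1
      have hpt_eq : c x y + pt y = vprice c pt x := hyt.1
      refine le_csSup (hbdd x) ⟨y, hD x hx ▸ hyt, ?_⟩
      linarith [hv x]
    · rw [integral_undef hi]
      exact integral_nonneg hsup0
  · simp only [hProfit, hsupeq]
end
end

section
/- The reformulated profit maximization problem in the second model admits at least one solution: there exists a (Q₁,c)-concave function w* : Q → ℝ such that J(w) ≤ J(w*) for every (Q₁,c)-concave function w : Q → ℝ, where J(w) = ∫_{{x : w(x) ≤ v₀(x)}} ( w(x) − min_{y ∈ ∂^{1,c} w(x)} c(x,y) ) df(x). -/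
open Filter Set MeasureTheory

noncomputable section

/-- A function `w : Q → ℝ` is `(Q₁,c)`-concave if `w x = inf_{y ∈ Q₁} (c x y - u y)`
for some `u : Q → ℝ` bounded from above on `Q₁`. -/
def QcConcave {Q : Type*} (c : Q → Q → ℝ) (Q₁ : Set Q) (w : Q → ℝ) : Prop :=
  ∃ u : Q → ℝ, BddAbove (u '' Q₁) ∧ ∀ x, w x = sInf ((fun y => c x y - u y) '' Q₁)

/-- The reformulated profit functional
`J(w) = ∫_{{w ≤ v₀}} ( w x - min_{y ∈ ∂^{1,c} w(x)} c x y ) df(x)`. -/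
def Jfun {Q : Type*} [MeasurableSpace Q] (f : Measure Q) (c : Q → Q → ℝ)
    (Q₁ : Set Q) (v₀ : Q → ℝ) (w : Q → ℝ) : ℝ :=
  ∫ x in {x | w x ≤ v₀ x},
    (w x - sInf ((fun y => c x y) '' QcSuperdiff c Q₁ w x)) ∂f

section General

variable {Q : Type*}

/-- The function `c · y` touches `w` at `x` up to a constant:
`y ∈ S` and `x` minimizes `c · y - w`. -/
def Touches (c : Q → Q → ℝ) (S : Set Q) (w : Q → ℝ) (x y : Q) : Prop :=
  y ∈ S ∧ ∀ x', c x y - w x ≤ c x' y - w x'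

/-- The integrand of `Jfun`: the profit made from customers at `x`. -/
def profit (c : Q → Q → ℝ) (S : Set Q) (w : Q → ℝ) (x : Q) : ℝ :=
  w x - sInf ((fun y => c x y) '' QcSuperdiff c S w x)

theorem le_cost_sub_of_eq_sInf {c : Q → Q → ℝ} {S : Set Q} {w u : Q → ℝ}
    (hc0 : ∀ x y, 0 ≤ c x y) (hu : BddAbove (u '' S))
    (hw : ∀ x, w x = sInf ((fun y => c x y - u y) '' S)) (x : Q) {y : Q} (hy : y ∈ S) :
    w x ≤ c x y - u y := by
  rw [hw]
  obtain ⟨M, hM⟩ := hu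
  refine csInf_le ⟨-M, ?_⟩ (mem_image_of_mem _ hy)
  rintro _ ⟨z, hz, rfl⟩
  have := hM (mem_image_of_mem u hz)
  have := hc0 x z
  simp only
  linarith

theorem Touches.ctransform_eq {c : Q → Q → ℝ} {S : Set Q} {w : Q → ℝ} {x y : Q}
    (h : Touches c S w x y) : ctransform c w y = c x y - w x := by
  refine IsLeast.csInf_eq ⟨mem_range_self x, ?_⟩
  rintro _ ⟨x', rfl⟩
  exact h.2 x'

theorem isClosed_touches [MetricSpace Q] {c : Q → Q → ℝ} {S : Set Q}
    (hc : Continuous fun z : Q × Q => c z.1 z.2) (hSc : IsClosed S) :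
    IsClosed {z : (BoundedContinuousFunction Q ℝ × Q) × Q | Touches c S z.1.1 z.1.2 z.2} := by
  have hev : Continuous fun p : BoundedContinuousFunction Q ℝ × Q => p.1 p.2 :=
    continuous_eval
  refine IsClosed.and (hSc.preimage continuous_snd) ?_
  simp only [ofPred_forall]
  refine isClosed_iInter fun x' => isClosed_le ?_ ?_
  · exact (hc.comp (continuous_fst.snd.prodMk continuous_snd)).sub (hev.comp continuous_fst)
  · exact (hc.comp (continuous_const.prodMk continuous_snd)).sub
      (hev.comp (continuous_fst.fst.prodMk continuous_const))

section Topological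

variable [MetricSpace Q] [CompactSpace Q] {c : Q → Q → ℝ} {S : Set Q} {w : Q → ℝ}

theorem exists_dist_cost_lt (hc : Continuous fun z : Q × Q => c z.1 z.2) {ε : ℝ} (hε : 0 < ε) :
    ∃ δ > 0, ∀ x x', dist x x' < δ → ∀ y, c x y - c x' y < ε := by
  have hu := CompactSpace.uniformContinuous_of_continuous hc
  obtain ⟨δ, hδ, h⟩ := Metric.uniformContinuous_iff.1 hu ε hε
  refine ⟨δ, hδ, fun x x' hx y => ?_⟩
  have := h (a := (x, y)) (b := (x', y)) (by simpa [Prod.dist_eq] using hx)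
  exact (le_abs_self _).trans_lt this

theorem QcConcave.continuous (hc : Continuous fun z : Q × Q => c z.1 z.2)
    (hc0 : ∀ x y, 0 ≤ c x y) (hS : S.Nonempty) (h : QcConcave c S w) : Continuous w := by
  obtain ⟨u, hu, hw⟩ := h
  rw [Metric.continuous_iff']
  intro x ε hε
  obtain ⟨δ, hδ, h⟩ := exists_dist_cost_lt hc (half_pos hε)
  have key : ∀ x x', dist x x' < δ → w x - ε / 2 ≤ w x' := by
    intro x x' hx
    rw [hw x']
    refine le_csInf (hS.image _) ?_
    rintro _ ⟨y, hy, rfl⟩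
    have := le_cost_sub_of_eq_sInf hc0 hu hw x hy
    have := h x x' hx y
    simp only
    linarith
  filter_upwards [Metric.ball_mem_nhds x hδ] with x' hx'
  have h1 := key x' x hx'
  have h2 := key x x' (by rwa [dist_comm])
  rw [Real.dist_eq, abs_lt]
  constructor <;> linarith

theorem QcConcave.exists_touches (hc : Continuous fun z : Q × Q => c z.1 z.2)
    (hc0 : ∀ x y, 0 ≤ c x y) (hSc : IsClosed S) (hS : S.Nonempty) (h : QcConcave c S w) (x : Q) :
    ∃ y, Touches c S w x y := by
  obtain ⟨u, hu, hw⟩ := h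
  have hbdd : BddBelow ((fun y => c x y - u y) '' S) := by
    refine ⟨w x, ?_⟩
    rintro _ ⟨y, hy, rfl⟩
    exact le_cost_sub_of_eq_sInf hc0 hu hw x hy
  obtain ⟨v, -, hv, hvS⟩ := exists_seq_tendsto_sInf (hS.image _) hbdd
  choose y hyS hy using hvS
  obtain ⟨y₀, hy₀, φ, hφ, hlim⟩ := hSc.isCompact.tendsto_subseq hyS
  refine ⟨y₀, hy₀, fun x' => ?_⟩
  have hcx : ∀ x, Tendsto (fun n => c x (y (φ n))) atTop (nhds (c x y₀)) := fun x =>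
    ((hc.comp (Continuous.prodMk_right x)).tendsto y₀).comp hlim
  have hlim' := ((hcx x').sub (hcx x)).add (hv.comp hφ.tendsto_atTop)
  rw [← hw] at hlim'
  have : w x' ≤ c x' y₀ - c x y₀ + w x := by
    refine ge_of_tendsto' hlim' fun n => ?_
    have h1 := le_cost_sub_of_eq_sInf hc0 hu hw x' (hyS (φ n))
    have h2 := hy (φ n)
    simp only [Function.comp] at h2 ⊢
    linarith
  linarith

theorem bddBelow_range_cost_sub (hc : Continuous fun z : Q × Q => c z.1 z.2) (hw : Continuous w)
    (y : Q) : BddBelow (range fun x => c x y - w x) :=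
  (isCompact_range ((hc.comp (Continuous.prodMk_left y)).sub hw)).bddBelow

theorem mem_qcSuperdiff_iff (hc : Continuous fun z : Q × Q => c z.1 z.2) (hw : Continuous w)
    {x y : Q} : y ∈ QcSuperdiff c S w x ↔ Touches c S w x y := by
  refine ⟨fun h => ⟨h.1, fun x' => ?_⟩, fun h => ⟨h.1, by rw [h.ctransform_eq]; ring⟩⟩
  have h1 := h.2
  have h2 : ctransform c w y ≤ c x' y - w x' := ciInf_le (bddBelow_range_cost_sub hc hw y) x'
  linarith

theorem le_cost_sub_ctransform (hc : Continuous fun z : Q × Q => c z.1 z.2) (hw : Continuous w)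
    (x y : Q) : w x ≤ c x y - ctransform c w y := by
  have : ctransform c w y ≤ c x y - w x := ciInf_le (bddBelow_range_cost_sub hc hw y) x
  linarith

theorem exists_cost_le (hc : Continuous fun z : Q × Q => c z.1 z.2) : ∃ M, ∀ x y, c x y ≤ M := by
  obtain ⟨M, hM⟩ := (isCompact_range hc).bddAbove
  exact ⟨M, fun x y => hM (mem_range_self (x, y))⟩

theorem bddAbove_ctransform_image [Nonempty Q] (hc : Continuous fun z : Q × Q => c z.1 z.2)
    (hw : Continuous w) : BddAbove (ctransform c w '' S) := by
  obtain ⟨M, hM⟩ := exists_cost_le hc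
  let x₀ : Q := Classical.arbitrary Q
  refine ⟨M - w x₀, ?_⟩
  rintro _ ⟨y, -, rfl⟩
  have := le_cost_sub_ctransform hc hw x₀ y
  have := hM x₀ y
  linarith

theorem qcConcave_of_touches [Nonempty Q] (hc : Continuous fun z : Q × Q => c z.1 z.2)
    (hw : Continuous w) (h : ∀ x, ∃ y, Touches c S w x y) : QcConcave c S w := by
  refine ⟨ctransform c w, bddAbove_ctransform_image hc hw, fun x => ?_⟩
  obtain ⟨y, hy⟩ := h x
  suffices hle : IsLeast ((fun y => c x y - ctransform c w y) '' S) (w x) from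
    hle.csInf_eq.symm
  refine ⟨⟨y, hy.1, ?_⟩, ?_⟩
  · simp only [hy.ctransform_eq]
    ring
  · rintro _ ⟨z, -, rfl⟩
    exact le_cost_sub_ctransform hc hw x z

theorem isClosed_exists_touches (hc : Continuous fun z : Q × Q => c z.1 z.2) (hSc : IsClosed S) :
    IsClosed {z : BoundedContinuousFunction Q ℝ × Q | ∃ y, Touches c S z.1 z.2 y} := by
  convert isClosedMap_fst_of_compactSpace _ (isClosed_touches hc hSc) using 1
  ext z
  simp

theorem isClosed_exists_touches_le (hc : Continuous fun z : Q × Q => c z.1 z.2) (hSc : IsClosed S)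
    (a : ℝ) : IsClosed {z : BoundedContinuousFunction Q ℝ × Q |
      ∃ y, Touches c S z.1 z.2 y ∧ a ≤ z.1 z.2 - c z.2 y} := by
  have hev : Continuous fun p : BoundedContinuousFunction Q ℝ × Q => p.1 p.2 :=
    continuous_eval
  have h : IsClosed {z : (BoundedContinuousFunction Q ℝ × Q) × Q |
      a ≤ z.1.1 z.1.2 - c z.1.2 z.2} :=
    isClosed_le continuous_const ((hev.comp continuous_fst).sub
      (hc.comp (continuous_fst.snd.prodMk continuous_snd)))
  convert isClosedMap_fst_of_compactSpace _ ((isClosed_touches hc hSc).inter h) using 1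
  ext z
  simp

theorem exists_touches_profit_eq (hc : Continuous fun z : Q × Q => c z.1 z.2) (hSc : IsClosed S)
    (hw : Continuous w) {x : Q} (h : ∃ y, Touches c S w x y) :
    ∃ y, Touches c S w x y ∧ profit c S w x = w x - c x y := by
  have hcx : Continuous (c x) := hc.comp (Continuous.prodMk_right x)
  have hset : QcSuperdiff c S w x = {y | Touches c S w x y} :=
    ext fun y => mem_qcSuperdiff_iff hc hw
  have hcl : IsClosed {y | Touches c S w x y} :=
    (isClosed_touches hc hSc).preimage
      (Continuous.prodMk_right ((BoundedContinuousFunction.mkOfCompact ⟨w, hw⟩, x)))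
  obtain ⟨y, hy, hmin⟩ := hcl.isCompact.exists_sInf_image_eq h hcx.continuousOn
  exact ⟨y, hy, by rw [profit, hset, ← hmin]⟩

theorem Touches.le_profit (hc : Continuous fun z : Q × Q => c z.1 z.2) (hw : Continuous w)
    {x y : Q} (h : Touches c S w x y) : w x - c x y ≤ profit c S w x := by
  have hbdd : BddBelow ((fun y => c x y) '' QcSuperdiff c S w x) :=
    (isCompact_range (hc.comp (Continuous.prodMk_right x))).bddBelow.mono (image_subset_range _ _)
  have := csInf_le hbdd (mem_image_of_mem _ ((mem_qcSuperdiff_iff hc hw).2 h))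
  unfold profit
  linarith

theorem le_profit_iff (hc : Continuous fun z : Q × Q => c z.1 z.2) (hSc : IsClosed S)
    (hw : Continuous w) {x : Q} (h : ∃ y, Touches c S w x y) {a : ℝ} :
    a ≤ profit c S w x ↔ ∃ y, Touches c S w x y ∧ a ≤ w x - c x y := by
  constructor
  · intro ha
    obtain ⟨y, hy, he⟩ := exists_touches_profit_eq hc hSc hw h
    exact ⟨y, hy, he ▸ ha⟩
  · rintro ⟨y, hy, ha⟩
    exact ha.trans (hy.le_profit hc hw)

theorem profit_nonneg (hc : Continuous fun z : Q × Q => c z.1 z.2) (hcd : ∀ x, c x x = 0)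
    (hw : Continuous w) (hw0 : ∀ x, 0 ≤ w x) {x : Q} (h : ∃ y, Touches c S w x y) :
    0 ≤ profit c S w x := by
  obtain ⟨y, hy⟩ := h
  have h1 := hy.2 y
  have h2 := hy.le_profit hc hw
  have h3 := hw0 y
  rw [hcd] at h1
  linarith

theorem profit_le (hc : Continuous fun z : Q × Q => c z.1 z.2) (hc0 : ∀ x y, 0 ≤ c x y)
    (hSc : IsClosed S) (hw : Continuous w) {x : Q} (h : ∃ y, Touches c S w x y) :
    profit c S w x ≤ w x := by
  obtain ⟨y, -, hy⟩ := exists_touches_profit_eq hc hSc hw h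
  have := hc0 x y
  linarith

/-- Functions with values in `[0, B]` all of whose superdifferentials are nonempty. -/
def feasible (c : Q → Q → ℝ) (S : Set Q) (B : ℝ) : Set (BoundedContinuousFunction Q ℝ) :=
  {w | (∀ x, w x ∈ Icc 0 B) ∧ ∀ x, ∃ y, Touches c S w x y}

theorem isCompact_feasible (hc : Continuous fun z : Q × Q => c z.1 z.2) (hSc : IsClosed S)
    (B : ℝ) : IsCompact (feasible c S B) := by
  refine BoundedContinuousFunction.arzela_ascoli₂ (Icc 0 B) isCompact_Icc _ ?_
    (fun w x hw => hw.1 x) ?_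
  · have h1 : IsClosed {w : BoundedContinuousFunction Q ℝ | ∀ x, w x ∈ Icc 0 B} := by
      simp only [ofPred_forall]
      exact isClosed_iInter fun x => isClosed_Icc.preimage (continuous_eval_const x)
    have h2 : IsClosed {w : BoundedContinuousFunction Q ℝ | ∀ x, ∃ y, Touches c S w x y} := by
      simp only [ofPred_forall]
      exact isClosed_iInter fun x =>
        (isClosed_exists_touches hc hSc).preimage (Continuous.prodMk_left x)
    exact h1.and h2
  · refine UniformEquicontinuous.equicontinuous (Metric.uniformEquicontinuous_iff.2 ?_)
    intro ε hε
    obtain ⟨δ, hδ, h⟩ := exists_dist_cost_lt hc hε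
    have key : ∀ w ∈ feasible c S B, ∀ x x', dist x x' < δ → w x - w x' < ε := by
      intro w hw x x' hx
      obtain ⟨y, hy⟩ := hw.2 x'
      have h1 := hy.2 x
      have h2 := h x x' hx y
      linarith
    refine ⟨δ, hδ, fun x x' hx w => ?_⟩
    rw [Real.dist_eq, abs_lt]
    have h1 := key w w.2 x x' hx
    have h2 := key w w.2 x' x (by rwa [dist_comm])
    constructor <;> linarith

theorem limsup_indicator_profit_le (hc : Continuous fun z : Q × Q => c z.1 z.2)
    (hSc : IsClosed S) {v₀ : Q → ℝ} {W : ℕ → BoundedContinuousFunction Q ℝ}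
    {W₀ : BoundedContinuousFunction Q ℝ} (hW : ∀ n x, ∃ y, Touches c S (W n) x y)
    (hW₀ : ∀ x, ∃ y, Touches c S W₀ x y) (hlim : Tendsto W atTop (nhds W₀)) (x : Q) :
    limsup (fun n => indicator {x | W n x ≤ v₀ x}
        (fun x => ENNReal.ofReal (profit c S (W n) x)) x) atTop ≤
      indicator {x | W₀ x ≤ v₀ x} (fun x => ENNReal.ofReal (profit c S W₀ x)) x := by
  refine le_of_forall_lt_imp_le_of_dense fun b hb => ?_
  rcases eq_zero_or_pos b with rfl | hb0
  · exact zero_le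
  have hfreq := frequently_lt_of_lt_limsup (by isBoundedDefault) hb
  have hclosed : IsClosed {V : BoundedContinuousFunction Q ℝ |
      V x ≤ v₀ x ∧ ∃ y, Touches c S V x y ∧ b.toReal ≤ V x - c x y} :=
    (isClosed_le (continuous_eval_const x) continuous_const).and
      ((isClosed_exists_touches_le hc hSc b.toReal).preimage (Continuous.prodMk_left x))
  have hfreq' : ∃ᶠ n in atTop, W n ∈ {V : BoundedContinuousFunction Q ℝ |
      V x ≤ v₀ x ∧ ∃ y, Touches c S V x y ∧ b.toReal ≤ V x - c x y} := by
    refine hfreq.mono fun n hn => ?_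
    have hmem : W n x ≤ v₀ x := by
      by_contra hx
      rw [indicator_of_notMem (by exact hx)] at hn
      exact not_lt_zero hn
    rw [indicator_of_mem (by exact hmem)] at hn
    refine ⟨hmem, (le_profit_iff hc hSc (W n).continuous (hW n x)).1 ?_⟩
    exact (ENNReal.lt_ofReal_iff_toReal_lt hn.ne_top).1 hn |>.le
  obtain ⟨hmem, hex⟩ := hclosed.mem_of_frequently_of_tendsto hfreq' hlim
  rw [indicator_of_mem (by exact hmem)]
  have hbp := (le_profit_iff hc hSc W₀.continuous (hW₀ x)).2 hex
  exact (ENNReal.ofReal_toReal hb.ne_top).symm.trans_le (ENNReal.ofReal_le_ofReal hbp)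

section Measure

variable [MeasurableSpace Q] [BorelSpace Q]

theorem measurable_profit (hc : Continuous fun z : Q × Q => c z.1 z.2) (hSc : IsClosed S)
    (hw : Continuous w) (h : ∀ x, ∃ y, Touches c S w x y) : Measurable (profit c S w) := by
  refine measurable_of_Ici fun a => IsClosed.measurableSet ?_
  convert (isClosed_exists_touches_le hc hSc a).preimage
    (Continuous.prodMk_right (BoundedContinuousFunction.mkOfCompact ⟨w, hw⟩)) using 1
  ext x
  exact le_profit_iff hc hSc hw (h x)

theorem integrable_profit (hc : Continuous fun z : Q × Q => c z.1 z.2) (hSc : IsClosed S)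
    (hw : Continuous w) (h : ∀ x, ∃ y, Touches c S w x y) (f : Measure Q) [IsFiniteMeasure f] :
    Integrable (profit c S w) f := by
  obtain ⟨C, hC⟩ := (isCompact_range hc.norm).bddAbove
  obtain ⟨W, hW⟩ := (isCompact_range hw.norm).bddAbove
  refine Integrable.of_bound (measurable_profit hc hSc hw h).aestronglyMeasurable (W + C)
    (Eventually.of_forall fun x => ?_)
  obtain ⟨y, -, hy⟩ := exists_touches_profit_eq hc hSc hw (h x)
  rw [hy]
  exact (norm_sub_le _ _).trans
    (add_le_add (hW (mem_range_self x)) (hC (mem_range_self (x, y))))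

variable {v₀ : Q → ℝ}

theorem Jfun_eq_toReal (hc : Continuous fun z : Q × Q => c z.1 z.2) (hcd : ∀ x, c x x = 0)
    (hSc : IsClosed S) (hw : Continuous w) (hw0 : ∀ x, 0 ≤ w x)
    (h : ∀ x, ∃ y, Touches c S w x y) (f : Measure Q) :
    Jfun f c S v₀ w =
      (∫⁻ x in {x | w x ≤ v₀ x}, ENNReal.ofReal (profit c S w x) ∂f).toReal :=
  integral_eq_lintegral_of_nonneg_ae
    (Eventually.of_forall fun x => profit_nonneg hc hcd hw hw0 (h x))
    (measurable_profit hc hSc hw h).aestronglyMeasurable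

theorem exists_nonneg_Jfun_le [Nonempty Q] (hc : Continuous fun z : Q × Q => c z.1 z.2)
    (hc0 : ∀ x y, 0 ≤ c x y) (hcd : ∀ x, c x x = 0) (hSc : IsClosed S) (hS : S.Nonempty)
    (hv : Continuous v₀) (f : Measure Q) [IsFiniteMeasure f] (hw : QcConcave c S w) :
    ∃ w', QcConcave c S w' ∧ (∀ x, 0 ≤ w' x) ∧ Jfun f c S v₀ w ≤ Jfun f c S v₀ w' := by
  have hwc := hw.continuous hc hc0 hS
  have hwt := hw.exists_touches hc hc0 hSc hS
  set u : Q → ℝ := fun y => min (ctransform c w y) 0 with hu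
  set w' : Q → ℝ := fun x => sInf ((fun y => c x y - u y) '' S) with hw'
  have hub : BddAbove (u '' S) := by
    refine ⟨0, ?_⟩
    rintro _ ⟨y, -, rfl⟩
    exact min_le_right _ _
  have hq : QcConcave c S w' := ⟨u, hub, fun _ => rfl⟩
  have hw'0 : ∀ x, 0 ≤ w' x := by
    intro x
    refine le_csInf (hS.image _) ?_
    rintro _ ⟨y, -, rfl⟩
    have h1 : u y ≤ 0 := min_le_right _ _
    have h2 := hc0 x y
    simp only
    linarith
  have hww' : ∀ x, w x ≤ w' x := by
    intro x
    refine le_csInf (hS.image _) ?_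
    rintro _ ⟨y, -, rfl⟩
    have h1 : u y ≤ ctransform c w y := min_le_left _ _
    have h2 := le_cost_sub_ctransform hc hwc x y
    simp only
    linarith
  have hw'c := hq.continuous hc hc0 hS
  have hw't := hq.exists_touches hc hc0 hSc hS
  refine ⟨w', hq, hw'0, ?_⟩
  have hm : MeasurableSet {x | w x ≤ v₀ x} := (isClosed_le hwc hv).measurableSet
  have hm' : MeasurableSet {x | w' x ≤ v₀ x} := (isClosed_le hw'c hv).measurableSet
  change ∫ x in _, profit c S w x ∂f ≤ ∫ x in _, profit c S w' x ∂f
  rw [← integral_indicator hm, ← integral_indicator hm']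
  refine integral_mono ((integrable_profit hc hSc hwc hwt f).indicator hm)
    ((integrable_profit hc hSc hw'c hw't f).indicator hm') fun x => ?_
  have hpos : 0 ≤ indicator {x | w' x ≤ v₀ x} (profit c S w') x :=
    indicator_nonneg (fun x _ => profit_nonneg hc hcd hw'c hw'0 (hw't x)) x
  by_cases hx : w x ≤ v₀ x
  swap
  · rwa [indicator_of_notMem (by exact hx)]
  rw [indicator_of_mem (by exact hx)]
  rcases le_or_gt (profit c S w x) 0 with hle | hgt
  · exact hle.trans hpos
  obtain ⟨y, hy, hp⟩ := exists_touches_profit_eq hc hSc hwc (hwt x)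
  have hcy := hy.ctransform_eq
  have huy : u y = ctransform c w y := min_eq_left (by linarith)
  have hle : ∀ x', w' x' ≤ c x' y - u y := fun x' =>
    le_cost_sub_of_eq_sInf hc0 hub (fun _ => rfl) x' hy.1
  have h1 := hle x
  have h2 := hww' x
  have hmem : w' x ≤ v₀ x := by linarith
  have hy' : Touches c S w' x y := ⟨hy.1, fun x' => by
    have := hle x'
    linarith⟩
  rw [indicator_of_mem (by exact hmem), hp]
  have := hy'.le_profit hc hw'c
  linarith

theorem exists_lintegral_profit_max (hc : Continuous fun z : Q × Q => c z.1 z.2)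
    (hc0 : ∀ x y, 0 ≤ c x y)
    (hSc : IsClosed S) (hv : Continuous v₀) (f : Measure Q) [IsFiniteMeasure f] {B : ℝ}
    (hne : (feasible c S B).Nonempty) :
    ∃ W₀ ∈ feasible c S B, ∀ W ∈ feasible c S B,
      ∫⁻ x in {x | W x ≤ v₀ x}, ENNReal.ofReal (profit c S W x) ∂f ≤
        ∫⁻ x in {x | W₀ x ≤ v₀ x}, ENNReal.ofReal (profit c S W₀ x) ∂f := by
  set Φ : BoundedContinuousFunction Q ℝ → ENNReal := fun W =>
    ∫⁻ x in {x | W x ≤ v₀ x}, ENNReal.ofReal (profit c S W x) ∂f with hΦ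
  have hm : ∀ W : BoundedContinuousFunction Q ℝ, MeasurableSet {x | W x ≤ v₀ x} := fun W =>
    (isClosed_le W.continuous hv).measurableSet
  obtain ⟨v, -, hvlim, hvmem⟩ := exists_seq_tendsto_sSup (hne.image Φ) (OrderTop.bddAbove _)
  choose W hWmem hWv using hvmem
  obtain ⟨W₀, hW₀, φ, hφ, hlim⟩ := (isCompact_feasible hc hSc B).tendsto_subseq hWmem
  refine ⟨W₀, hW₀, fun W' hW' => (le_sSup (mem_image_of_mem Φ hW')).trans ?_⟩
  have hs : Tendsto (fun n => Φ (W (φ n))) atTop (nhds (sSup (Φ '' feasible c S B))) := by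
    simpa only [hWv, Function.comp_def] using hvlim.comp hφ.tendsto_atTop
  rw [← hs.limsup_eq]
  simp only [hΦ, ← lintegral_indicator (hm _)]
  refine (limsup_lintegral_le (fun _ => ENNReal.ofReal B) (fun n => ?_) (fun n => ?_) ?_).trans
    (lintegral_mono fun x => limsup_indicator_profit_le hc hSc
      (fun n => (hWmem (φ n)).2) hW₀.2 hlim x)
  · exact (measurable_profit hc hSc (W (φ n)).continuous
      (hWmem (φ n)).2).ennreal_ofReal.indicator (hm _)
  · refine Eventually.of_forall fun x => indicator_apply_le' (fun _ => ?_) (fun _ => zero_le)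
    exact ENNReal.ofReal_le_ofReal ((profit_le hc hc0 hSc (W (φ n)).continuous
      ((hWmem (φ n)).2 x)).trans ((hWmem (φ n)).1 x).2)
  · rw [lintegral_const]
    exact ENNReal.mul_ne_top ENNReal.ofReal_ne_top (measure_ne_top f _)

end Measure

end Topological

end General

/-- The reformulated profit maximization problem in the subregion model admits at
least one solution. -/
theorem exists_maximizer_J
    {Q : Type*} [MetricSpace Q] [CompactSpace Q] [Nonempty Q]
    [MeasurableSpace Q] [BorelSpace Q]
    (Q₀ : Set Q) (hQ₀ : IsOpen Q₀) (hQ₀ne : Q₀.Nonempty) (hQ₁ : Q₀ᶜ.Nonempty)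
    (c : Q → Q → ℝ) (hc : Continuous fun z : Q × Q => c z.1 z.2)
    (hc0 : ∀ x y, 0 ≤ c x y) (hcd : ∀ x, c x x = 0)
    (p₀ : Q → ℝ) (hp₀lsc : LowerSemicontinuousOn p₀ Q₀) (hp₀0 : ∀ x ∈ Q₀, 0 ≤ p₀ x)
    (f : Measure Q) [IsFiniteMeasure f] (hf : f ≠ 0)
    (v₀ : Q → ℝ) (hv₀ : ∀ x, v₀ x = sInf ((fun y => c x y + p₀ y) '' Q₀)) :
    ∃ wstar : Q → ℝ, QcConcave c Q₀ᶜ wstar ∧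
      ∀ w : Q → ℝ, QcConcave c Q₀ᶜ w →
        Jfun f c Q₀ᶜ v₀ w ≤ Jfun f c Q₀ᶜ v₀ wstar := by
  have hSc : IsClosed Q₀ᶜ := hQ₀.isClosed_compl
  have hvq : QcConcave c Q₀ v₀ := by
    refine ⟨fun y => -p₀ y, ⟨0, ?_⟩, fun x => by simp only [hv₀, sub_neg_eq_add]⟩
    rintro _ ⟨y, hy, rfl⟩
    exact neg_nonpos.2 (hp₀0 y hy)
  have hv : Continuous v₀ := hvq.continuous hc hc0 hQ₀ne
  obtain ⟨M, hM⟩ := exists_cost_le hc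
  obtain ⟨V, hV⟩ := (isCompact_range hv).bddAbove
  set B : ℝ := M + |V| with hB
  have hfeas : ∀ w, QcConcave c Q₀ᶜ w → (∀ x, 0 ≤ w x) → (∃ x, w x ≤ |V|) →
      ∃ W ∈ feasible c Q₀ᶜ B, ⇑W = w := by
    rintro w hw hw0 ⟨x, hx⟩
    have hwt := hw.exists_touches hc hc0 hSc hQ₁
    refine ⟨BoundedContinuousFunction.mkOfCompact ⟨w, hw.continuous hc hc0 hQ₁⟩,
      ⟨fun x' => ⟨hw0 x', ?_⟩, hwt⟩, rfl⟩
    obtain ⟨y, hy⟩ := hwt x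
    have h1 := hy.2 x'
    have h2 := hM x' y
    have h3 := hc0 x y
    change w x' ≤ B
    linarith
  have hne : (feasible c Q₀ᶜ B).Nonempty := by
    obtain ⟨y₁, hy₁⟩ := hQ₁
    have hb : BddAbove ((fun _ : Q => (0 : ℝ)) '' Q₀ᶜ) := by
      refine ⟨0, ?_⟩
      rintro _ ⟨_, -, rfl⟩
      exact le_rfl
    obtain ⟨W, hW, -⟩ := hfeas (fun x => sInf ((fun y => c x y - 0) '' Q₀ᶜ))
      ⟨fun _ => 0, hb, fun _ => rfl⟩
      (fun x => le_csInf (Nonempty.image _ ⟨y₁, hy₁⟩) (by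
        rintro _ ⟨y, -, rfl⟩
        simpa using hc0 x y))
      ⟨y₁, (le_cost_sub_of_eq_sInf hc0 hb (fun _ => rfl) y₁ hy₁).trans
        (by simp [hcd])⟩
    exact ⟨W, hW⟩
  obtain ⟨W₀, hW₀, hmax⟩ := exists_lintegral_profit_max hc hc0 hSc hv f hne
  have hJ : ∀ W ∈ feasible c Q₀ᶜ B, Jfun f c Q₀ᶜ v₀ W = _ := fun W hW =>
    Jfun_eq_toReal (v₀ := v₀) hc hcd hSc W.continuous (fun x => (hW.1 x).1) hW.2 f
  refine ⟨W₀, qcConcave_of_touches hc W₀.continuous hW₀.2, fun w hw => ?_⟩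
  obtain ⟨w', hw', hw'0, hle⟩ := exists_nonneg_Jfun_le hc hc0 hcd hSc hQ₁ hv f hw
  refine hle.trans ?_
  rw [hJ W₀ hW₀]
  by_cases hx : ∃ x, w' x ≤ |V|
  · obtain ⟨W, hW, rfl⟩ := hfeas w' hw' hw'0 hx
    rw [hJ W hW]
    refine ENNReal.toReal_mono ?_ (hmax W hW)
    have hi := integrable_profit hc hSc W₀.continuous hW₀.2 f
    exact (hasFiniteIntegral_iff_ofReal (Eventually.of_forall fun x =>
      profit_nonneg hc hcd W₀.continuous (fun x => (hW₀.1 x).1) (hW₀.2 x))).1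
      hi.integrableOn.hasFiniteIntegral |>.ne
  · push Not at hx
    have hempty : {x | w' x ≤ v₀ x} = ∅ := by
      refine eq_empty_of_forall_notMem fun x hxv => ?_
      have h1 := hx x
      have h2 := hV (mem_range_self x)
      have h3 := le_abs_self V
      exact absurd (show w' x ≤ v₀ x from hxv) (by linarith)
    rw [Jfun, hempty, Measure.restrict_empty, integral_zero_measure]
    exact ENNReal.toReal_nonneg
end
end

section
/- Let Ω be a bounded open convex subset of ℝ^d, Q = closure of Ω, c(x,y) = ‖x − y‖, Q₀ an open subset of Q, Q₁ = Q \ Q₀ nonempty, p₀ : Q₀ → [0,∞) lower semicontinuous, v₀(x) = inf_{y∈Q₀}(‖x − y‖ + p₀(y)), and f a finite nonnegative Borel measure on Q. Let w be (Q₁,c)-concave and define u(x) := min_{y ∈ Q₁} { ‖x − y‖ + min(w(y), v₀(y)) } for x ∈ Q. Then u is (Q₁,c)-concave and J(u) ≥ J(w), where J(w) = ∫_{{w ≤ v₀}} ( w(x) − min_{y ∈ ∂^{1,c} w(x)} ‖x − y‖ ) df(x). -/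
open Filter Set MeasureTheory

noncomputable section

/-- A function `w` is `(Q₁,c)`-concave relative to `Q` if
`w x = inf_{y ∈ Q₁} (c x y - u y)` for every `x ∈ Q`, for some `u` bounded above
on `Q₁`. -/
def QcConcaveOn {E : Type*} (c : E → E → ℝ) (Q Q₁ : Set E) (w : E → ℝ) : Prop :=
  ∃ u : E → ℝ, BddAbove (u '' Q₁) ∧
    ∀ x ∈ Q, w x = sInf ((fun y => c x y - u y) '' Q₁)

/-- The `c`-transform relative to `Q`: `w^c(y) = inf_{x ∈ Q} (c x y - w x)`. -/
def ctransformOn {E : Type*} (c : E → E → ℝ) (Q : Set E) (w : E → ℝ) (y : E) : ℝ :=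
  sInf ((fun x => c x y - w x) '' Q)

/-- The `(Q₁,c)`-superdifferential relative to `Q`:
`∂^{1,c} w(x) = {y ∈ Q₁ : w x + w^c y = c x y}`. -/
def QcSuperdiffOn {E : Type*} (c : E → E → ℝ) (Q Q₁ : Set E) (w : E → ℝ) (x : E) :
    Set E :=
  {y ∈ Q₁ | w x + ctransformOn c Q w y = c x y}

/-- The profit functional
`J(w) = ∫_{{x ∈ Q : w x ≤ v₀ x}} ( w x - min_{y ∈ ∂^{1,c} w(x)} ‖x - y‖ ) df(x)`. -/
def Jeik {E : Type*} [MeasurableSpace E] (f : Measure E) (Q Q₁ : Set E)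
    [NormedAddCommGroup E] (v₀ : E → ℝ) (w : E → ℝ) : ℝ :=
  ∫ x in {x ∈ Q | w x ≤ v₀ x},
    (w x - sInf ((fun y => ‖x - y‖) ''
      QcSuperdiffOn (fun x y => ‖x - y‖) Q Q₁ w x)) ∂f

section Concave

variable {E : Type*} [NormedAddCommGroup E] {Q Q₁ : Set E} {w : E → ℝ} {x y : E}

/-- An infimum of cones with slope one and bounded-below heights is `1`-Lipschitz. -/
theorem lipschitzOnWith_sInf_cone {S : Set E} (hS : S.Nonempty) {g : E → ℝ}
    (hg : BddBelow (g '' S)) (hw : ∀ x ∈ Q, w x = sInf ((fun y => ‖x - y‖ + g y) '' S)) :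
    LipschitzOnWith 1 w Q := by
  obtain ⟨m, hm⟩ := hg
  refine LipschitzOnWith.of_le_add fun x hx y hy => ?_
  rw [hw x hx, hw y hy, ← sub_le_iff_le_add]
  refine le_csInf (hS.image _) ?_
  rintro _ ⟨z, hz, rfl⟩
  have hbdd : BddBelow ((fun z => ‖x - z‖ + g z) '' S) := by
    refine ⟨m, ?_⟩
    rintro _ ⟨t, ht, rfl⟩
    have := hm (mem_image_of_mem g ht)
    have := norm_nonneg (x - t)
    simp only
    linarith
  have h1 := csInf_le hbdd (mem_image_of_mem _ hz)
  have h2 := norm_sub_le_norm_sub_add_norm_sub x y z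
  rw [dist_eq_norm]
  simp only at h1 ⊢
  linarith

theorem LipschitzOnWith.le_add_norm (hL : LipschitzOnWith 1 w Q) (hx : x ∈ Q) (hy : y ∈ Q) :
    w x ≤ w y + ‖x - y‖ := by
  have := hL.le_add_mul hx hy
  simpa [dist_eq_norm] using this

theorem QcConcaveOn.lipschitzOnWith (hQ₁ : Q₁.Nonempty)
    (hw : QcConcaveOn (fun x y => ‖x - y‖) Q Q₁ w) : LipschitzOnWith 1 w Q := by
  obtain ⟨a, ⟨M, hM⟩, ha⟩ := hw
  refine lipschitzOnWith_sInf_cone hQ₁ (g := fun y => - a y) ⟨-M, ?_⟩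
    (by simpa [sub_eq_add_neg] using ha)
  rintro _ ⟨y, hy, rfl⟩
  exact neg_le_neg (hM (mem_image_of_mem a hy))

/-- The infimum defining a `(Q₁,c)`-concave function may be taken with `-w` as potential,
and is then attained. -/
theorem QcConcaveOn.exists_eq_add_norm (hQ₁ : Q₁.Nonempty) (hQ₁c : IsCompact Q₁) (hsub : Q₁ ⊆ Q)
    (hw : QcConcaveOn (fun x y => ‖x - y‖) Q Q₁ w) (hx : x ∈ Q) :
    ∃ y ∈ Q₁, w x = w y + ‖x - y‖ := by
  have hL := hw.lipschitzOnWith hQ₁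
  obtain ⟨y, hy, hmin⟩ := hQ₁c.exists_isMinOn hQ₁ (f := fun y => w y + ‖x - y‖)
    ((hL.continuousOn.mono hsub).add (by fun_prop))
  refine ⟨y, hy, (hL.le_add_norm hx (hsub hy)).antisymm ?_⟩
  obtain ⟨a, ⟨M, hM⟩, ha⟩ := hw
  rw [ha x hx]
  refine le_csInf (hQ₁.image _) ?_
  rintro _ ⟨z, hz, rfl⟩
  have h1 : w y + ‖x - y‖ ≤ w z + ‖x - z‖ := hmin hz
  have h2 : w z ≤ ‖z - z‖ - a z := by
    rw [ha z (hsub hz)]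
    refine csInf_le ⟨-M, ?_⟩ (mem_image_of_mem (fun y => ‖z - y‖ - a y) hz)
    rintro _ ⟨t, ht, rfl⟩
    have := hM (mem_image_of_mem a ht)
    have := norm_nonneg (z - t)
    simp only
    linarith
  simp only [sub_self, norm_zero] at h2 ⊢
  linarith

theorem ctransformOn_eq_neg (hL : LipschitzOnWith 1 w Q) (hy : y ∈ Q) :
    ctransformOn (fun x y => ‖x - y‖) Q w y = - w y := by
  refine IsLeast.csInf_eq ⟨⟨y, hy, by simp⟩, ?_⟩
  rintro _ ⟨x, hx, rfl⟩
  have := hL.le_add_norm hx hy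
  simp only
  linarith

theorem mem_QcSuperdiffOn_iff (hL : LipschitzOnWith 1 w Q) (hsub : Q₁ ⊆ Q) :
    y ∈ QcSuperdiffOn (fun x y => ‖x - y‖) Q Q₁ w x ↔ y ∈ Q₁ ∧ w x = w y + ‖x - y‖ := by
  refine and_congr_right fun hy => ?_
  rw [ctransformOn_eq_neg hL (hsub hy)]
  constructor <;> intro h <;> linarith

theorem QcConcaveOn.superdiff_nonempty (hQ₁ : Q₁.Nonempty) (hQ₁c : IsCompact Q₁) (hsub : Q₁ ⊆ Q)
    (hw : QcConcaveOn (fun x y => ‖x - y‖) Q Q₁ w) (hx : x ∈ Q) :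
    (QcSuperdiffOn (fun x y => ‖x - y‖) Q Q₁ w x).Nonempty := by
  obtain ⟨y, hy⟩ := hw.exists_eq_add_norm hQ₁ hQ₁c hsub hx
  exact ⟨y, (mem_QcSuperdiffOn_iff (hw.lipschitzOnWith hQ₁) hsub).2 hy⟩

theorem bddBelow_norm_sub_image (x : E) (S : Set E) : BddBelow ((fun y => ‖x - y‖) '' S) :=
  ⟨0, by rintro _ ⟨y, -, rfl⟩; exact norm_nonneg _⟩

theorem isCompact_QcSuperdiffOn (hL : LipschitzOnWith 1 w Q) (hQ₁c : IsCompact Q₁)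
    (hsub : Q₁ ⊆ Q) : IsCompact (QcSuperdiffOn (fun x y => ‖x - y‖) Q Q₁ w x) := by
  have : QcSuperdiffOn (fun x y => ‖x - y‖) Q Q₁ w x = {y ∈ Q₁ | w x = w y + ‖x - y‖} :=
    Set.ext fun y => mem_QcSuperdiffOn_iff hL hsub
  rw [this]
  refine hQ₁c.of_isClosed_subset ?_ (sep_subset _ _)
  have hc : ContinuousOn (fun y => w y + ‖x - y‖) Q₁ :=
    (hL.continuousOn.mono hsub).add (by fun_prop)
  have := hc.preimage_isClosed_of_isClosed hQ₁c.isClosed (isClosed_singleton (x := w x))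
  convert this using 1
  ext y
  simp [eq_comm]

/-- The distance to the superdifferential has closed sublevel sets. -/
theorem isClosed_sInf_superdiff_le (hQc : IsCompact Q) (hQ₁ : Q₁.Nonempty) (hQ₁c : IsCompact Q₁)
    (hsub : Q₁ ⊆ Q) (hw : QcConcaveOn (fun x y => ‖x - y‖) Q Q₁ w) (t : ℝ) :
    IsClosed {x ∈ Q | sInf ((fun y => ‖x - y‖) ''
      QcSuperdiffOn (fun x y => ‖x - y‖) Q Q₁ w x) ≤ t} := by
  have hL := hw.lipschitzOnWith hQ₁
  have hprod := hQc.prod hQ₁c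
  have hG : IsClosed {p ∈ Q ×ˢ Q₁ | w p.2 + ‖p.1 - p.2‖ ≤ w p.1} := by
    refine hprod.isClosed.isClosed_le ?_ ?_
    · refine ContinuousOn.add ?_ (by fun_prop)
      exact hL.continuousOn.comp continuousOn_snd fun p hp => hsub hp.2
    · exact hL.continuousOn.comp continuousOn_fst fun p hp => hp.1
  have hT : IsClosed {p : E × E | ‖p.1 - p.2‖ ≤ t} := isClosed_le (by fun_prop) (by fun_prop)
  have hK := (hprod.of_isClosed_subset (hG.inter hT) fun p hp => hp.1.1).image continuous_fst
  convert hK.isClosed using 1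
  ext x
  constructor
  · rintro ⟨hx, hxt⟩
    obtain ⟨y, hy, hye⟩ := ((isCompact_QcSuperdiffOn (x := x) hL hQ₁c hsub).image
      (f := fun y => ‖x - y‖) (by fun_prop)).sInf_mem
      ((hw.superdiff_nonempty hQ₁ hQ₁c hsub hx).image _)
    obtain ⟨hy1, hy2⟩ := (mem_QcSuperdiffOn_iff hL hsub).1 hy
    exact ⟨(x, y), ⟨⟨⟨hx, hy1⟩, hy2.ge⟩, hye.trans_le hxt⟩, rfl⟩
  · rintro ⟨⟨x', y⟩, ⟨⟨⟨hx, hy⟩, h⟩, ht⟩, rfl⟩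
    refine ⟨hx, (csInf_le (bddBelow_norm_sub_image _ _) (mem_image_of_mem _ ?_)).trans ht⟩
    exact (mem_QcSuperdiffOn_iff hL hsub).2 ⟨hy, (hL.le_add_norm hx (hsub hy)).antisymm h⟩

theorem integrableOn_profit [MeasurableSpace E] [BorelSpace E] (f : Measure E) [IsFiniteMeasure f]
    (hQc : IsCompact Q) (hQ₁ : Q₁.Nonempty) (hQ₁c : IsCompact Q₁)
    (hsub : Q₁ ⊆ Q) (hw : QcConcaveOn (fun x y => ‖x - y‖) Q Q₁ w) :
    IntegrableOn (fun x => w x - sInf ((fun y => ‖x - y‖) ''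
      QcSuperdiffOn (fun x y => ‖x - y‖) Q Q₁ w x)) Q f := by
  have hL := hw.lipschitzOnWith hQ₁
  refine (hL.continuousOn.integrableOn_compact hQc).sub ?_
  obtain ⟨C, hC⟩ := Metric.isBounded_iff.1 hQc.isBounded
  have hmeas : AEMeasurable (fun x => sInf ((fun y => ‖x - y‖) ''
      QcSuperdiffOn (fun x y => ‖x - y‖) Q Q₁ w x)) (f.restrict Q) := by
    refine aemeasurable_restrict_of_measurable_subtype hQc.measurableSet
      (measurable_of_Iic fun t => ?_)
    convert measurable_subtype_coe
      (isClosed_sInf_superdiff_le hQc hQ₁ hQ₁c hsub hw t).measurableSet using 1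
    ext x
    simp
  refine Integrable.of_bound hmeas.aestronglyMeasurable C ?_
  refine (ae_restrict_iff' hQc.measurableSet).2 (ae_of_all _ fun x hx => ?_)
  obtain ⟨y, hy⟩ := hw.superdiff_nonempty hQ₁ hQ₁c hsub hx
  rw [Real.norm_of_nonneg (Real.sInf_nonneg
    (by rintro _ ⟨z, -, rfl⟩; exact norm_nonneg _))]
  refine (csInf_le (bddBelow_norm_sub_image _ _) (mem_image_of_mem _ hy)).trans ?_
  simpa [dist_eq_norm] using hC hx (hsub hy.1)

end Concave

/-- Truncating a `(Q₁,c)`-concave function at `v₀` on `Q₁` and regularizing yields a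
`(Q₁,c)`-concave function with larger profit: if
`u(x) = min_{y ∈ Q₁} (‖x - y‖ + min (w y) (v₀ y))`, then `u` is `(Q₁,c)`-concave and
`J(u) ≥ J(w)`. -/
theorem Jeik_truncation_improves
    {d : ℕ} (Ω : Set (EuclideanSpace ℝ (Fin d)))
    (hΩo : IsOpen Ω) (hΩb : Bornology.IsBounded Ω) (hΩc : Convex ℝ Ω)
    (Q₀ : Set (EuclideanSpace ℝ (Fin d)))
    (hQ₀sub : Q₀ ⊆ closure Ω) (hQ₀ne : Q₀.Nonempty)
    (hQ₀open : ∃ U : Set (EuclideanSpace ℝ (Fin d)), IsOpen U ∧ Q₀ = U ∩ closure Ω)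
    (hQ₁ne : (closure Ω \ Q₀).Nonempty)
    (p₀ : EuclideanSpace ℝ (Fin d) → ℝ)
    (hp₀lsc : LowerSemicontinuousOn p₀ Q₀) (hp₀0 : ∀ x ∈ Q₀, 0 ≤ p₀ x)
    (v₀ : EuclideanSpace ℝ (Fin d) → ℝ)
    (hv₀ : ∀ x, v₀ x = sInf ((fun y => ‖x - y‖ + p₀ y) '' Q₀))
    (f : Measure (EuclideanSpace ℝ (Fin d))) [IsFiniteMeasure f]
    (w : EuclideanSpace ℝ (Fin d) → ℝ)
    (hw : QcConcaveOn (fun x y => ‖x - y‖) (closure Ω) (closure Ω \ Q₀) w)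
    (u : EuclideanSpace ℝ (Fin d) → ℝ)
    (hu : ∀ x, u x = sInf ((fun y => ‖x - y‖ + min (w y) (v₀ y)) '' (closure Ω \ Q₀))) :
    QcConcaveOn (fun x y => ‖x - y‖) (closure Ω) (closure Ω \ Q₀) u ∧
      Jeik f (closure Ω) (closure Ω \ Q₀) v₀ w ≤
        Jeik f (closure Ω) (closure Ω \ Q₀) v₀ u := by
  have hQc : IsCompact (closure Ω) := hΩb.isCompact_closure
  have hsub : closure Ω \ Q₀ ⊆ closure Ω := sdiff_subset
  have hQ₁c : IsCompact (closure Ω \ Q₀) := by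
    obtain ⟨U, hU, rfl⟩ := hQ₀open
    rw [inter_comm, sdiff_self_inter]
    exact hQc.diff hU
  set Q := closure Ω
  set Q₁ := Q \ Q₀
  have hLw := hw.lipschitzOnWith hQ₁ne
  have hLv : LipschitzOnWith 1 v₀ Q := by
    refine lipschitzOnWith_sInf_cone hQ₀ne (g := p₀) ⟨0, ?_⟩ fun x _ => hv₀ x
    rintro _ ⟨y, hy, rfl⟩
    exact hp₀0 y hy
  have hv0 : ∀ x, 0 ≤ v₀ x := fun x => by
    rw [hv₀ x]
    refine Real.sInf_nonneg ?_
    rintro _ ⟨y, hy, rfl⟩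
    exact add_nonneg (norm_nonneg _) (hp₀0 y hy)
  obtain ⟨m, hm⟩ := hQc.bddBelow_image hLw.continuousOn
  have hmin : ∀ y ∈ Q₁, min m 0 ≤ min (w y) (v₀ y) := fun y hy =>
    min_le_min (hm (mem_image_of_mem w (hsub hy))) (hv0 y)
  have hcu : QcConcaveOn (fun x y => ‖x - y‖) Q Q₁ u := by
    refine ⟨fun y => - min (w y) (v₀ y), ⟨- min m 0, ?_⟩, fun x _ => ?_⟩
    · rintro _ ⟨y, hy, rfl⟩
      exact neg_le_neg (hmin y hy)
    · simp only [sub_neg_eq_add]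
      exact hu x
  refine ⟨hcu, ?_⟩
  have hLu := hcu.lipschitzOnWith hQ₁ne
  have hu_le : ∀ x, ∀ y ∈ Q₁, u x ≤ ‖x - y‖ + min (w y) (v₀ y) := fun x y hy => by
    rw [hu x]
    refine csInf_le ⟨min m 0, ?_⟩ (mem_image_of_mem (fun y => ‖x - y‖ + min (w y) (v₀ y)) hy)
    rintro _ ⟨z, hz, rfl⟩
    exact (hmin z hz).trans (le_add_of_nonneg_left (norm_nonneg _))
  have hle_u : ∀ x ∈ Q, min (w x) (v₀ x) ≤ u x := fun x hx => by
    rw [hu x]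
    refine le_csInf (hQ₁ne.image _) ?_
    rintro _ ⟨y, hy, rfl⟩
    have h1 := hLw.le_add_norm hx (hsub hy)
    have h2 := hLv.le_add_norm hx (hsub hy)
    simp only [← min_add_add_left]
    exact min_le_min (by linarith) (by linarith)
  have hu_Q₁ : ∀ y ∈ Q₁, u y = min (w y) (v₀ y) := fun y hy =>
    le_antisymm (by simpa using hu_le y y hy) (hle_u y (hsub hy))
  have hu_le_w : ∀ x ∈ Q, u x ≤ w x := fun x hx => by
    obtain ⟨y, hy, hxy⟩ := hw.exists_eq_add_norm hQ₁ne hQ₁c hsub hx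
    have h1 := hu_le x y hy
    have h2 := min_le_left (w y) (v₀ y)
    linarith
  have hIw := integrableOn_profit f hQc hQ₁ne hQ₁c hsub hw
  have hIu := integrableOn_profit f hQc hQ₁ne hQ₁c hsub hcu
  have hA : MeasurableSet {x ∈ Q | w x ≤ v₀ x} :=
    (hQc.isClosed.isClosed_le hLw.continuousOn hLv.continuousOn).measurableSet
  have hB : MeasurableSet {x ∈ Q | u x ≤ v₀ x} :=
    (hQc.isClosed.isClosed_le hLu.continuousOn hLv.continuousOn).measurableSet
  have hAB : {x ∈ Q | w x ≤ v₀ x} ⊆ {x ∈ Q | u x ≤ v₀ x} := fun x hx =>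
    ⟨hx.1, (hu_le_w x hx.1).trans hx.2⟩
  unfold Jeik
  rw [← integral_inter_add_sdiff hA (hIu.mono_set (sep_subset Q _)), inter_eq_right.2 hAB]
  refine le_add_of_le_of_nonneg (setIntegral_mono_on (hIw.mono_set (sep_subset Q _))
    (hIu.mono_set (sep_subset Q _)) hA ?_) (setIntegral_nonneg (hB.diff hA) ?_)
  · rintro x ⟨hx, hxv⟩
    have hux : u x = w x :=
      (hu_le_w x hx).antisymm ((min_eq_left hxv).symm.trans_le (hle_u x hx))
    rw [hux]
    refine sub_le_sub_left (csInf_le_csInf (bddBelow_norm_sub_image _ _)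
      ((hw.superdiff_nonempty hQ₁ne hQ₁c hsub hx).image _) (image_mono fun y hy => ?_)) _
    obtain ⟨hy1, hy2⟩ := (mem_QcSuperdiffOn_iff hLw hsub).1 hy
    refine (mem_QcSuperdiffOn_iff hLu hsub).2 ⟨hy1, ?_⟩
    have h1 := hLv.le_add_norm hx (hsub hy1)
    rw [hux, hu_Q₁ y hy1, min_eq_left (by linarith), hy2]
  · rintro x ⟨⟨hx, hxu⟩, hxw⟩
    have hxw' : v₀ x < w x := lt_of_not_ge fun h => hxw ⟨hx, h⟩
    obtain ⟨y, hy⟩ := hcu.superdiff_nonempty hQ₁ne hQ₁c hsub hx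
    obtain ⟨hy1, hy2⟩ := (mem_QcSuperdiffOn_iff hLu hsub).1 hy
    refine sub_nonneg.2 ((csInf_le (bddBelow_norm_sub_image _ _) (mem_image_of_mem _ hy)).trans ?_)
    have h1 := hLw.le_add_norm hx (hsub hy1)
    have h2 := hv0 y
    have h3 : 0 ≤ u y := by
      rcases min_choice (w y) (v₀ y) with h | h
      · have := (hu_Q₁ y hy1).trans h
        linarith
      · exact h2.trans_eq ((hu_Q₁ y hy1).trans h).symm
    linarith
end
end
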